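/- Let n+s be even and f ∈ WRP with sign ε and dual g, and consider the code C_{D_{f,sq}} with defining set D_{f,sq} = {x ∈ F_q : f(x) ∈ SQ}. If ε η_0(−1)^{(n+s)/2} = 1 and 0 ≤ s ≤ n−6, then C_{D_{f,sq}} is a minimal linear code with parameters [((p−1)/2)(p^{n−1} − p^{(n+s−2)/2}), n, ((p−1)²/2)p^{n−2} − (p−1)p^{(n+s−2)/2}]_p. If ε η_0(−1)^{(n+s)/2} = −1 and 0 ≤ s ≤ n−4, then C_{D_{f,sq}} is a minimal linear code with parameters [((p−1)/2)(p^{n−1} + p^{(n+s−2)/2}), n, ((p−1)²/2)p^{n−2}]_p. -/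

import Mathlib

open scoped BigOperators Classical

noncomputable section

/-- `ξ_p^j` for `j : ZMod p`, where `ξ_p = exp(2πi/p)` and the exponent `j`
is lifted to a natural number. -/
def ep (p : ℕ) (j : ZMod p) : ℂ :=
  Complex.exp (2 * Real.pi * Complex.I * (j.val : ℂ) / (p : ℂ))

/-- `√(p*)`: equal to `√p` if `p ≡ 1 (mod 4)` and to `i√p` if `p ≡ 3 (mod 4)`. -/
def sqrtPStar (p : ℕ) : ℂ :=
  if p % 4 = 1 then ((Real.sqrt p : ℝ) : ℂ) else Complex.I * ((Real.sqrt p : ℝ) : ℂ)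

/-- The quadratic character `η₀` of `F_p` (extended by `η₀(0) = 0`), with values in `ℂ`. -/
def eta0 (p : ℕ) [Fact p.Prime] (j : ZMod p) : ℂ :=
  ((quadraticChar (ZMod p) j : ℤ) : ℂ)

/-- The Walsh transform of `f : F_q → F_p`. -/
def walsh (p : ℕ) {F : Type*} [Field F] [Fintype F] [Algebra (ZMod p) F]
    (f : F → ZMod p) (β : F) : ℂ :=
  ∑ x : F, ep p (f x - Algebra.trace (ZMod p) F (β * x))

/-- `f` is weakly regular `s`-plateaued with sign `ε` and dual `g`:
`W_f(β) = ε √(p*)^{n+s} ξ_p^{g(β)}` on the Walsh support, `W_f(β) = 0` off it,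
and `g` vanishes off the Walsh support. -/
def IsWeaklyRegularPlateaued (p n s : ℕ) {F : Type*} [Field F] [Fintype F]
    [Algebra (ZMod p) F] (f : F → ZMod p) (ε : ℂ) (g : F → ZMod p) : Prop :=
  (ε = 1 ∨ ε = -1) ∧
  (∀ β : F, walsh p f β ≠ 0 →
      walsh p f β = ε * sqrtPStar p ^ (n + s) * ep p (g β)) ∧
  (∀ β : F, walsh p f β = 0 → g β = 0)

/-- `f` lies in the class `WRP`: weakly regular `s`-plateaued with sign `ε` and dual `g`,
unbalanced, `f(0) = 0`, and `f(ax) = a^h f(x)` for some positive even `h` with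
`gcd(h-1, p-1) = 1`. -/
def IsWRP (p n s : ℕ) {F : Type*} [Field F] [Fintype F]
    [Algebra (ZMod p) F] (f : F → ZMod p) (ε : ℂ) (g : F → ZMod p) : Prop :=
  IsWeaklyRegularPlateaued p n s f ε g ∧
  walsh p f 0 ≠ 0 ∧
  f 0 = 0 ∧
  ∃ h : ℕ, 0 < h ∧ Even h ∧ Nat.gcd (h - 1) (p - 1) = 1 ∧
    ∀ (a : (ZMod p)ˣ) (x : F),
      f (algebraMap (ZMod p) F (a : ZMod p) * x) = (a : ZMod p) ^ h * f x

/-- The defining set `D_f = {x ∈ F_q^* : f(x) = 0}`. -/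
def Dzero (p : ℕ) {F : Type*} [Field F] [Fintype F] [Algebra (ZMod p) F]
    (f : F → ZMod p) : Finset F :=
  Finset.univ.filter fun x => x ≠ 0 ∧ f x = 0

/-- The defining set `D_{f,sq} = {x ∈ F_q : f(x) ∈ SQ}`. -/
def Dsq (p : ℕ) {F : Type*} [Field F] [Fintype F] [Algebra (ZMod p) F]
    (f : F → ZMod p) : Finset F :=
  Finset.univ.filter fun x => f x ≠ 0 ∧ IsSquare (f x)

/-- The defining set `D_{f,nsq} = {x ∈ F_q : f(x) ∈ NSQ}`. -/
def Dnsq (p : ℕ) {F : Type*} [Field F] [Fintype F] [Algebra (ZMod p) F]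
    (f : F → ZMod p) : Finset F :=
  Finset.univ.filter fun x => f x ≠ 0 ∧ ¬ IsSquare (f x)

/-- The codeword `c_β = (Tr(βd))_{d ∈ D}` of the code `C_D`. -/
def cword (p : ℕ) {F : Type*} [Field F] [Fintype F] [Algebra (ZMod p) F]
    (D : Finset F) (β : F) : D → ZMod p :=
  fun d => Algebra.trace (ZMod p) F (β * (d : F))

/-- The Hamming weight of the codeword `c_β` of the code `C_D`. -/
def wtOn (p : ℕ) {F : Type*} [Field F] [Fintype F] [Algebra (ZMod p) F]
    (D : Finset F) (β : F) : ℕ :=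
  (D.filter fun d => Algebra.trace (ZMod p) F (β * d) ≠ 0).card

/-- `u` covers `v` : the support of `v` is contained in the support of `u`. -/
def Covers {k : ℕ} {ι : Type*} (u v : ι → ZMod k) : Prop :=
  ∀ i, v i ≠ 0 → u i ≠ 0

/-- The code `C_D` is minimal: every nonzero codeword covers only its own
nonzero scalar multiples among the nonzero codewords. -/
def IsMinimalCode (p : ℕ) {F : Type*} [Field F] [Fintype F] [Algebra (ZMod p) F]
    (D : Finset F) : Prop :=
  ∀ β : F, cword p D β ≠ 0 →
    ∀ β' : F, cword p D β' ≠ 0 → Covers (cword p D β) (cword p D β') →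
      ∃ a : ZMod p, a ≠ 0 ∧ cword p D β' = a • cword p D β

/-- The code `C_D` is an `[m, n, d]_p` code: length `m`, dimension `n`
(i.e. `β ↦ c_β` is injective, so the code has `p^n` codewords), and minimum
nonzero Hamming weight `d`. -/
def HasParams (p : ℕ) {F : Type*} [Field F] [Fintype F] [Algebra (ZMod p) F]
    (D : Finset F) (m d : ℤ) : Prop :=
  (D.card : ℤ) = m ∧
  Function.Injective (cword p D) ∧
  (∀ β : F, cword p D β ≠ 0 → d ≤ (wtOn p D β : ℤ)) ∧
  (∃ β : F, cword p D β ≠ 0 ∧ (wtOn p D β : ℤ) = d)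

section ShiftCounts

variable {p : ℕ} [Fact p.Prime] {F : Type*} [Field F] [Fintype F] [Algebra (ZMod p) F]

theorem sum_mul_ep_eq_zero_iff (a : ZMod p → ℤ) :
    ∑ c, (a c : ℂ) * ep p c = 0 ↔ ∀ c d, a c = a d := by
  have hp : p.Prime := Fact.out
  obtain ⟨k, rfl⟩ : ∃ k, p = k + 1 := ⟨p - 1, by have := hp.pos; omega⟩
  have hζ := Complex.isPrimitiveRoot_exp (k + 1) (by omega)
  refine (Eq.congr_left (Finset.sum_congr rfl fun c _ => ?_)).trans
    (hζ.sum_eq_zero_iff_forall_eq_int hp a)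
  rw [ep, ← Complex.exp_nat_mul]
  congr 2
  change _ = ((ZMod.val c : ℕ) : ℂ) * _
  ring

/-- For `β ≠ 0`, the map `x ↦ Tr(βx)` takes every value equally often. -/
theorem mul_sum_trace_eq {β : F} (hβ : β ≠ 0) (c : ZMod p) :
    (p : ℤ) * ∑ x : F, (if Algebra.trace (ZMod p) F (β * x) = c then 1 else 0) =
      Fintype.card F := by
  have : FiniteDimensional (ZMod p) F := Module.Finite.of_finite
  let φ : F →+ ZMod p :=
    ((Algebra.trace (ZMod p) F).comp (LinearMap.mulLeft (ZMod p) β)).toAddMonoidHom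
  have hφ : Function.Surjective φ := fun c => by
    obtain ⟨y, hy⟩ := Algebra.trace_surjective (ZMod p) F c
    exact ⟨β⁻¹ * y, by simpa [φ, hβ] using hy⟩
  have key (d : ZMod p) : ∑ x : F, (if φ x = d then (1 : ℤ) else 0) =
      ∑ x : F, (if φ x = c then (1 : ℤ) else 0) := by
    simp only [Finset.sum_boole]
    exact_mod_cast AddMonoidHom.card_fiber_eq_of_mem_range φ (hφ d) (hφ c)
  have total : ∑ d, ∑ x : F, (if φ x = d then (1 : ℤ) else 0) = Fintype.card F := by
    rw [Finset.sum_comm]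
    simp
  rw [Finset.sum_congr rfl fun d _ => key d] at total
  simp only [Finset.sum_const, Finset.card_univ, ZMod.card, nsmul_eq_mul] at total
  convert total
  rfl

/-- The number of `x` with `f(x) - Tr(βx) = c`. -/
def shiftCount (p : ℕ) {F : Type*} [Field F] [Fintype F] [Algebra (ZMod p) F]
    (f : F → ZMod p) (β : F) (c : ZMod p) : ℤ :=
  ∑ x : F, if f x - Algebra.trace (ZMod p) F (β * x) = c then 1 else 0

theorem sum_shiftCount (f : F → ZMod p) (β : F) :
    ∑ c, shiftCount p f β c = Fintype.card F := by
  simp only [shiftCount]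
  rw [Finset.sum_comm]
  simp

theorem walsh_eq_sum_shiftCount (f : F → ZMod p) (β : F) :
    walsh p f β = ∑ c, (shiftCount p f β c : ℂ) * ep p c := by
  simp only [shiftCount, Int.cast_sum, Finset.sum_mul]
  rw [Finset.sum_comm]
  simp [walsh]

/-- The value distribution of the functions `x ↦ f(x) - Tr(βx)` for a weakly regular plateaued
`f` with even parameter: constant off the Walsh support `S`, with one exceptional value `g(β)`
on it. -/
def HasShiftCounts (p : ℕ) {F : Type*} [Field F] [Fintype F] [Algebra (ZMod p) F]
    (f g : F → ZMod p) (S : Finset F) (K : ℤ) : Prop :=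
  ∀ β c, (p : ℤ) * shiftCount p f β c =
    Fintype.card F + if β ∈ S then K * (p * (if c = g β then 1 else 0) - 1) else 0

theorem hasShiftCounts_of_walsh {f g : F → ZMod p} {K : ℤ}
    (hW : ∀ β, walsh p f β ≠ 0 → walsh p f β = K * ep p (g β)) :
    HasShiftCounts p f g (Finset.univ.filter fun β => walsh p f β ≠ 0) K := by
  intro β c
  set L : ℤ := if walsh p f β ≠ 0 then K else 0 with hL
  have hW' : walsh p f β = L * ep p (g β) := by
    by_cases h : walsh p f β = 0
    · simp [hL, h]
    · rw [hL, if_pos h]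
      exact hW β h
  have hz : ∑ d, ((shiftCount p f β d - L * (if d = g β then 1 else 0) : ℤ) : ℂ) * ep p d = 0 := by
    simp [sub_mul, Finset.sum_sub_distrib, ← walsh_eq_sum_shiftCount, hW']
  rw [sum_mul_ep_eq_zero_iff] at hz
  have hsum : ∑ d, (shiftCount p f β d - L * (if d = g β then 1 else 0)) =
      Fintype.card F - L := by
    simp [Finset.sum_sub_distrib, sum_shiftCount]
  rw [Finset.sum_congr rfl fun d _ => hz d c] at hsum
  simp only [Finset.sum_const, Finset.card_univ, ZMod.card, nsmul_eq_mul] at hsum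
  have : (if β ∈ Finset.univ.filter fun β => walsh p f β ≠ 0 then
      K * (p * (if c = g β then 1 else 0) - 1) else 0) =
      L * ((p : ℤ) * (if c = g β then 1 else 0) - 1) := by
    by_cases h : walsh p f β = 0 <;> simp [hL, h]
  rw [this]
  linear_combination hsum

theorem two_ne_zero_zmod {p : ℕ} [Fact p.Prime] (hp : p ≠ 2) : (2 : ZMod p) ≠ 0 := by
  intro h
  have := (ZMod.natCast_eq_zero_iff 2 p).mp (by exact_mod_cast h)
  exact hp ((Nat.prime_dvd_prime_iff_eq Fact.out Nat.prime_two).mp this)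

theorem odd_shiftCount_zero_iff (hp : p ≠ 2) {f : F → ZMod p} (hf0 : f 0 = 0)
    (hneg : ∀ x, f (-x) = f x) (c : ZMod p) : Odd (shiftCount p f 0 c) ↔ c = 0 := by
  have two : (2 : F) ≠ 0 := by
    rw [← map_ofNat (algebraMap (ZMod p) F) 2]
    exact (map_ne_zero (algebraMap (ZMod p) F)).mpr (two_ne_zero_zmod hp)
  have key : ∑ x ∈ Finset.univ.erase (0 : F), (if f x = c then (1 : ZMod 2) else 0) = 0 := by
    refine Finset.sum_involution (fun x _ => -x) ?_ ?_ ?_ ?_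
    · intro x _
      rw [hneg]
      exact CharTwo.add_self_eq_zero _
    · intro x hx _ h
      have : 2 * x = 0 := by linear_combination -h
      simp_all
    · simp
    · simp
  have hodd : ((shiftCount p f 0 c : ℤ) : ZMod 2) = if c = 0 then 1 else 0 := by
    rw [shiftCount, Int.cast_sum, ← Finset.add_sum_erase _ _ (Finset.mem_univ 0)]
    simp only [zero_mul, map_zero, sub_zero, Int.cast_ite, Int.cast_one, Int.cast_zero, key, hf0]
    simp [eq_comm]
  rw [← ZMod.intCast_eq_one_iff_odd, hodd]
  simp

namespace HasShiftCounts

variable {f g : F → ZMod p} {S : Finset F} {K : ℤ}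

theorem dual_zero (H : HasShiftCounts p f g S K) (hp : p ≠ 2) (hf0 : f 0 = 0)
    (hneg : ∀ x, f (-x) = f x) : g 0 = 0 := by
  by_contra hg
  have h1 := H 0 0
  have h2 := H 0 (-g 0)
  have two : -g 0 ≠ g 0 := by
    intro h
    have : 2 * g 0 = 0 := by linear_combination -h
    simp_all [two_ne_zero_zmod hp]
  rw [if_neg (Ne.symm hg)] at h1
  rw [if_neg two, ← h1] at h2
  have hp0 : (p : ℤ) ≠ 0 := by exact_mod_cast (Fact.out : p.Prime).ne_zero
  have h3 := mul_left_cancel₀ hp0 h2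
  have h4 := (odd_shiftCount_zero_iff hp hf0 hneg (-g 0)).not.mpr (by simpa using hg)
  rw [h3] at h4
  exact h4 ((odd_shiftCount_zero_iff hp hf0 hneg 0).mpr rfl)

end HasShiftCounts

theorem shiftCount_scale {f : F → ZMod p} {h : ℕ} (hh : 0 < h) (t : (ZMod p)ˣ)
    (hft : ∀ x, f (algebraMap (ZMod p) F t * x) = (t : ZMod p) ^ h * f x) (β : F) (c : ZMod p) :
    shiftCount p f (algebraMap (ZMod p) F (t ^ (h - 1)) * β) (t ^ h * c) =
      shiftCount p f β c := by
  symm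
  have ht : algebraMap (ZMod p) F t ≠ 0 := by simp
  refine Fintype.sum_equiv (Equiv.mulLeft₀ _ ht) _ _ fun x => ?_
  have htr : Algebra.trace (ZMod p) F (algebraMap (ZMod p) F (t ^ (h - 1)) * β *
      (algebraMap (ZMod p) F t * x)) = (t : ZMod p) ^ h * Algebra.trace (ZMod p) F (β * x) := by
    rw [← smul_eq_mul (α := ZMod p), ← map_smul, Algebra.smul_def]
    obtain ⟨k, rfl⟩ := Nat.exists_eq_succ_of_ne_zero hh.ne'
    simp only [Nat.succ_eq_add_one, Nat.add_sub_cancel, map_pow]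
    congr 1
    ring
  simp only [Equiv.mulLeft₀_apply, hft, htr, ← mul_sub]
  simp

namespace HasShiftCounts

variable {f g : F → ZMod p} {S : Finset F} {K : ℤ}

theorem dual_scale (H : HasShiftCounts p f g S K) (hK : K ≠ 0) {h : ℕ} (hh : 0 < h)
    (t : (ZMod p)ˣ)
    (hft : ∀ x, f (algebraMap (ZMod p) F t * x) = (t : ZMod p) ^ h * f x) (β : F) :
    (algebraMap (ZMod p) F (t ^ (h - 1)) * β ∈ S ↔ β ∈ S) ∧
      (β ∈ S → g (algebraMap (ZMod p) F (t ^ (h - 1)) * β) = t ^ h * g β) := by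
  have hp1 : (p : ℤ) ≠ 1 := by exact_mod_cast (Fact.out : p.Prime).ne_one
  have hp0 : (p : ℤ) ≠ 0 := by exact_mod_cast (Fact.out : p.Prime).ne_zero
  have key (c : ZMod p) := (H (algebraMap (ZMod p) F (t ^ (h - 1)) * β) (t ^ h * c)).symm.trans
    ((congrArg _ (shiftCount_scale hh t hft β c)).trans (H β c))
  simp only [add_right_inj] at key
  have kβ := key (g β)
  by_cases h1 : algebraMap (ZMod p) F (t ^ (h - 1)) * β ∈ S <;> by_cases h2 : β ∈ S
  · simp only [h1, h2, if_true, true_and, forall_const] at kβ ⊢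
    have := mul_left_cancel₀ hK kβ
    by_contra hne
    rw [if_neg (Ne.symm hne)] at this
    omega
  · simp only [h1, h2, if_true, if_false] at kβ
    have := (mul_eq_zero.mp kβ).resolve_left hK
    exfalso
    split_ifs at this <;> omega
  · simp only [h1, h2, if_true, if_false] at kβ
    have := (mul_eq_zero.mp kβ.symm).resolve_left hK
    omega
  · simp only [h1, h2, false_implies, and_self]

end HasShiftCounts

/-- The indicator function of the nonzero squares of `F_p`. -/
def sqInd (p : ℕ) (c : ZMod p) : ℤ :=
  if c ≠ 0 ∧ IsSquare c then 1 else 0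

theorem two_mul_sum_sqInd (hp : p ≠ 2) : 2 * ∑ c : ZMod p, sqInd p c = p - 1 := by
  have h1 : ∑ c : ZMod p, quadraticChar (ZMod p) c = 0 :=
    quadraticChar_sum_zero (by rwa [ZMod.ringChar_zmod_n])
  have h2 (c : ZMod p) :
      2 * sqInd p c = quadraticChar (ZMod p) c + (1 - if c = 0 then 1 else 0) := by
    by_cases hc : c = 0
    · simp [sqInd, hc]
    · by_cases hs : IsSquare c
      · simp [sqInd, hc, hs, (quadraticChar_one_iff_isSquare hc).mpr hs]
      · simp [sqInd, hs, hc, quadraticChar_neg_one_iff_not_isSquare.mpr hs]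
  rw [Finset.mul_sum, Finset.sum_congr rfl fun c _ => h2 c, Finset.sum_add_distrib, h1]
  simp

theorem sqInd_le_one {p : ℕ} (c : ZMod p) : sqInd p c ≤ 1 := by
  unfold sqInd
  split_ifs <;> norm_num

theorem sqInd_nonneg {p : ℕ} (c : ZMod p) : 0 ≤ sqInd p c := by
  unfold sqInd
  split_ifs <;> norm_num

theorem sqInd_pow_mul {h : ℕ} (hh : Even h) (t : (ZMod p)ˣ) (c : ZMod p) :
    sqInd p (t ^ h * c) = sqInd p c := by
  have hiff : IsSquare ((t : ZMod p) ^ h * c) ↔ IsSquare c := by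
    have hsq : IsSquare ((t : ZMod p) ^ h) := hh.isSquare_pow _
    refine ⟨fun hc => ?_, hsq.mul⟩
    have := hc.div hsq
    rwa [mul_div_cancel_left₀ _ (by simp)] at this
  simp [sqInd, hiff]

/-- `f(ax) = a^h f(x)` for an even positive `h` with `gcd(h-1, p-1) = 1`. -/
def IsEvenHomogeneous (p : ℕ) {F : Type*} [Field F] [Fintype F] [Algebra (ZMod p) F]
    (f : F → ZMod p) : Prop :=
  ∃ h : ℕ, 0 < h ∧ Even h ∧ Nat.gcd (h - 1) (p - 1) = 1 ∧
    ∀ (a : (ZMod p)ˣ) (x : F),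
      f (algebraMap (ZMod p) F (a : ZMod p) * x) = (a : ZMod p) ^ h * f x

theorem IsEvenHomogeneous.map_neg {f : F → ZMod p} (hf : IsEvenHomogeneous p f) (x : F) :
    f (-x) = f x := by
  obtain ⟨h, -, heven, -, hf⟩ := hf
  simpa [heven.neg_one_pow] using hf (-1) x

theorem card_Dsq (f : F → ZMod p) : ((Dsq p f).card : ℤ) = ∑ x, sqInd p (f x) := by
  simp only [Dsq, sqInd, Finset.card_filter]
  push_cast
  congr!

theorem wtOn_Dsq (f : F → ZMod p) (β : F) :
    (wtOn p (Dsq p f) β : ℤ) = ∑ x, sqInd p (f x) -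
      ∑ x, sqInd p (f x) * (if Algebra.trace (ZMod p) F (β * x) = 0 then 1 else 0) := by
  rw [wtOn, Dsq, Finset.filter_filter, Finset.card_filter, ← Finset.sum_sub_distrib]
  push_cast
  refine Finset.sum_congr rfl fun x _ => ?_
  unfold sqInd
  by_cases h1 : f x ≠ 0 ∧ IsSquare (f x) <;>
    by_cases h2 : Algebra.trace (ZMod p) F (β * x) = 0 <;> simp [h1, h2]

theorem sum_shiftCount_mul (f : F → ZMod p) (β : F) (c : ZMod p) :
    ∑ z : ZMod p, shiftCount p f (algebraMap (ZMod p) F z * β) c =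
      ∑ x : F, ((if Algebra.trace (ZMod p) F (β * x) = 0 then 1 else 0) *
        ((p : ℤ) * (if f x = c then 1 else 0) - 1) + 1) := by
  simp only [shiftCount]
  rw [Finset.sum_comm]
  refine Finset.sum_congr rfl fun x _ => ?_
  have htr (z : ZMod p) : Algebra.trace (ZMod p) F (algebraMap (ZMod p) F z * β * x) =
      z * Algebra.trace (ZMod p) F (β * x) := by
    rw [← smul_eq_mul (α := ZMod p), ← map_smul, Algebra.smul_def, mul_assoc]
  simp only [htr]
  by_cases ht : Algebra.trace (ZMod p) F (β * x) = 0
  · simp [ht]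
  · have (z : ZMod p) : f x - z * Algebra.trace (ZMod p) F (β * x) = c ↔
        z = (f x - c) / Algebra.trace (ZMod p) F (β * x) := by
      rw [eq_div_iff ht]
      constructor <;> intro h <;> linear_combination (-1 : ZMod p) * h
    simp [this, ht]

theorem sum_sqInd_mul_ite (a : ZMod p) :
    ∑ c, sqInd p c * (if a = c then 1 else 0) = sqInd p a := by
  simp

theorem sum_sqInd_mul_sum_shiftCount (f : F → ZMod p) {β : F} (hβ : β ≠ 0) :
    p * ∑ c, sqInd p c * ∑ z : ZMod p, shiftCount p f (algebraMap (ZMod p) F z * β) c =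
      p ^ 2 * ∑ x, sqInd p (f x) * (if Algebra.trace (ZMod p) F (β * x) = 0 then 1 else 0) +
      (∑ c, sqInd p c) * (p - 1) * Fintype.card F := by
  have hswap : ∑ c, sqInd p c * ∑ z : ZMod p, shiftCount p f (algebraMap (ZMod p) F z * β) c =
      ∑ x : F, ((if Algebra.trace (ZMod p) F (β * x) = 0 then 1 else 0) *
        ((p : ℤ) * sqInd p (f x) - ∑ c, sqInd p c) + ∑ c, sqInd p c) := by
    simp only [sum_shiftCount_mul, Finset.mul_sum]
    rw [Finset.sum_comm]
    refine Finset.sum_congr rfl fun x _ => ?_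
    rw [← sum_sqInd_mul_ite (f x), Finset.mul_sum, ← Finset.sum_sub_distrib, Finset.mul_sum,
      ← Finset.sum_add_distrib]
    exact Finset.sum_congr rfl fun c _ => by ring
  have ht := mul_sum_trace_eq hβ (0 : ZMod p)
  have hsplit : ∑ x : F, ((if Algebra.trace (ZMod p) F (β * x) = 0 then 1 else 0) *
        ((p : ℤ) * sqInd p (f x) - ∑ c, sqInd p c) + ∑ c, sqInd p c) =
      p * ∑ x, sqInd p (f x) * (if Algebra.trace (ZMod p) F (β * x) = 0 then 1 else 0) -
      (∑ c, sqInd p c) * (∑ x, if Algebra.trace (ZMod p) F (β * x) = 0 then 1 else 0) +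
      Fintype.card F * ∑ c, sqInd p c := by
    rw [Finset.sum_add_distrib, Finset.sum_const, Finset.card_univ, nsmul_eq_mul]
    congr 1
    rw [Finset.mul_sum, Finset.mul_sum _ _ (∑ c, sqInd p c), ← Finset.sum_sub_distrib]
    exact Finset.sum_congr rfl fun x _ => by ring
  rw [hswap, hsplit]
  linear_combination -(∑ c, sqInd p c) * ht

namespace HasShiftCounts

variable {f g : F → ZMod p} {S : Finset F} {K : ℤ}

theorem sum_sqInd_mul (H : HasShiftCounts p f g S K) (β : F) :
    p * ∑ c, sqInd p c * shiftCount p f β c = (∑ c, sqInd p c) * Fintype.card F +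
      if β ∈ S then K * (p * sqInd p (g β) - ∑ c, sqInd p c) else 0 := by
  have h (c : ZMod p) : (p : ℤ) * (sqInd p c * shiftCount p f β c) =
      sqInd p c * Fintype.card F + if β ∈ S then
        K * (p * (sqInd p c * (if g β = c then 1 else 0)) - sqInd p c) else 0 := by
    rw [mul_left_comm, H β c]
    simp only [eq_comm (a := c)]
    split_ifs <;> ring
  rw [Finset.mul_sum, Finset.sum_congr rfl fun c _ => h c, Finset.sum_add_distrib,
    ← Finset.sum_mul]
  congr 1
  split_ifs
  · rw [← Finset.mul_sum, Finset.sum_sub_distrib, ← Finset.mul_sum, sum_sqInd_mul_ite]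
  · simp

theorem mul_card_Dsq (H : HasShiftCounts p f g S K) (h0 : 0 ∈ S) (hg0 : g 0 = 0) :
    p * ((Dsq p f).card : ℤ) = (∑ c, sqInd p c) * (Fintype.card F - K) := by
  have h1 : ((Dsq p f).card : ℤ) = ∑ c, sqInd p c * shiftCount p f 0 c := by
    rw [card_Dsq]
    simp only [shiftCount, Finset.mul_sum]
    rw [Finset.sum_comm]
    refine Finset.sum_congr rfl fun x _ => ?_
    rw [← sum_sqInd_mul_ite (f x)]
    simp
  rw [h1, H.sum_sqInd_mul, if_pos h0, hg0]
  simp only [sqInd, ne_eq, not_true_eq_false, false_and, if_false]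
  ring

theorem dual_smul (H : HasShiftCounts p f g S K) (hK : K ≠ 0) (hf : IsEvenHomogeneous p f)
    {z : ZMod p} (hz : z ≠ 0) (β : F) :
    (algebraMap (ZMod p) F z * β ∈ S ↔ β ∈ S) ∧
      (β ∈ S → sqInd p (g (algebraMap (ZMod p) F z * β)) = sqInd p (g β)) := by
  obtain ⟨h, hpos, heven, hgcd, hf⟩ := hf
  have hcop : (Nat.card (ZMod p)ˣ).Coprime (h - 1) := by
    rw [Nat.card_eq_fintype_card, ZMod.card_units p]
    exact Nat.Coprime.symm hgcd
  obtain ⟨t, ht⟩ := (powCoprime hcop).surjective (Units.mk0 z hz)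
  have htz : (t : ZMod p) ^ (h - 1) = z := by
    simpa using congrArg Units.val ht
  have := H.dual_scale hK hpos t (hf t) β
  rw [htz] at this
  refine ⟨this.1, fun hβ => ?_⟩
  rw [this.2 hβ, sqInd_pow_mul heven]

theorem sq_mul_wtOn (H : HasShiftCounts p f g S K) (hK : K ≠ 0) (hf : IsEvenHomogeneous p f)
    (h0 : 0 ∈ S) (hg0 : g 0 = 0) {β : F} (hβ : β ≠ 0) :
    (p : ℤ) ^ 2 * wtOn p (Dsq p f) β = (p - 1) * ((∑ c, sqInd p c) * (Fintype.card F - K) -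
      if β ∈ S then K * (p * sqInd p (g β) - ∑ c, sqInd p c) else 0) := by
  have hD := H.mul_card_Dsq h0 hg0
  have hM := sum_sqInd_mul_sum_shiftCount f hβ
  rw [wtOn_Dsq, ← card_Dsq]
  set B : F → ℤ := fun β => if β ∈ S then K * (p * sqInd p (g β) - ∑ c, sqInd p c) else 0
    with hB
  have hBz (z : ZMod p) (hz : z ≠ 0) : B (algebraMap (ZMod p) F z * β) = B β := by
    obtain ⟨h1, h2⟩ := H.dual_smul hK hf hz β
    by_cases h : β ∈ S
    · simp only [hB, h1, h, h2 h]
    · simp only [hB, h1, h, if_false]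
  have hB0 : B 0 = - K * ∑ c, sqInd p c := by
    simp [hB, h0, hg0, sqInd]
  have hL : p * ∑ c, sqInd p c * ∑ z : ZMod p, shiftCount p f (algebraMap (ZMod p) F z * β) c =
      p * ((∑ c, sqInd p c) * Fintype.card F) + (B 0 + (p - 1) * B β) := by
    simp only [Finset.mul_sum _ (fun z => shiftCount p f (algebraMap (ZMod p) F z * β) _)]
    rw [Finset.sum_comm, Finset.mul_sum, Finset.sum_congr rfl fun z _ => H.sum_sqInd_mul _,
      Finset.sum_add_distrib]
    congr 1
    · simp
    · change ∑ z, B (algebraMap (ZMod p) F z * β) = _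
      rw [← Finset.add_sum_erase _ _ (Finset.mem_univ 0),
        Finset.sum_congr rfl fun z hz => hBz z (Finset.ne_of_mem_erase hz)]
      simp [Finset.card_erase_of_mem, Nat.cast_sub (Fact.out : p.Prime).one_le]
  change _ = (p - 1) * (_ - B β)
  rw [hL, hB0] at hM
  linear_combination p * hD + hM

end HasShiftCounts
theorem mul_sum_trace_eq_ite (x : F) (c : ZMod p) :
    (p : ℤ) * ∑ β : F, (if Algebra.trace (ZMod p) F (β * x) = c then 1 else 0) =
      if x = 0 then (p : ℤ) * Fintype.card F * (if c = 0 then 1 else 0) else (Fintype.card F : ℤ) := by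
  by_cases hx : x = 0
  · simp [hx, eq_comm]
  · rw [if_neg hx, ← mul_sum_trace_eq hx c]
    simp only [mul_comm]

namespace HasShiftCounts

variable {f g : F → ZMod p} {S : Finset F} {K : ℤ}

theorem mul_card_fiber_dual (H : HasShiftCounts p f g S K) (hf0 : f 0 = 0) {c : ZMod p}
    (hc : c ≠ 0) :
    K * (p * ((S.filter fun β => g β = c).card : ℤ) - S.card) = -Fintype.card F := by
  have h1 : (p : ℤ) * ∑ β, shiftCount p f β c = (Fintype.card F - 1) * Fintype.card F := by
    simp only [shiftCount]
    rw [Finset.sum_comm, Finset.mul_sum]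
    have (x : F) : (p : ℤ) * ∑ β : F,
        (if f x - Algebra.trace (ZMod p) F (β * x) = c then 1 else 0) =
        if x = 0 then 0 else (Fintype.card F : ℤ) := by
      have hiff (β : F) : f x - Algebra.trace (ZMod p) F (β * x) = c ↔
          Algebra.trace (ZMod p) F (β * x) = f x - c := by
        constructor <;> intro h <;> linear_combination (-1 : ZMod p) * h
      simp only [hiff]
      rw [mul_sum_trace_eq_ite]
      split_ifs with hx hd
      · simp [hx, hf0, hc] at hd
      · simp
      · rfl
    rw [Finset.sum_congr rfl fun x _ => this x, ← Finset.add_sum_erase _ _ (Finset.mem_univ 0),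
      Finset.sum_congr rfl fun x hx => if_neg (Finset.ne_of_mem_erase hx)]
    simp [Finset.card_erase_of_mem, Nat.cast_sub Fintype.card_pos]
  have h2 : (p : ℤ) * ∑ β, shiftCount p f β c = Fintype.card F * Fintype.card F +
      K * (p * ((S.filter fun β => g β = c).card : ℤ) - S.card) := by
    rw [Finset.mul_sum, Finset.sum_congr rfl fun β _ => H β c, Finset.sum_add_distrib,
      Finset.sum_ite_mem, Finset.univ_inter, ← Finset.mul_sum, Finset.sum_sub_distrib,
      ← Finset.mul_sum, Finset.card_filter]
    simp only [eq_comm (a := c)]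
    simp
  linear_combination h1 - h2

theorem sq_mul_card (H : HasShiftCounts p f g S K) :
    K ^ 2 * S.card = (Fintype.card F : ℤ) ^ 2 := by
  have hp1 : (p : ℤ) - 1 ≠ 0 := by
    have : (p : ℤ) ≠ 1 := by exact_mod_cast (Fact.out : p.Prime).ne_one
    omega
  have h1 (β : F) : ∑ x, (p : ℤ) * shiftCount p f β (f x - Algebra.trace (ZMod p) F (β * x)) =
      Fintype.card F ^ 2 + if β ∈ S then K ^ 2 * (p - 1) else 0 := by
    have hg := H β (g β)
    rw [Finset.sum_congr rfl fun x _ => H β _, Finset.sum_add_distrib]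
    by_cases hβ : β ∈ S
    · simp only [hβ, if_true] at hg ⊢
      rw [← Finset.mul_sum, Finset.sum_sub_distrib, ← Finset.mul_sum, ← shiftCount]
      simp only [Finset.sum_const, Finset.card_univ, nsmul_eq_mul]
      linear_combination K * hg
    · simp [hβ, sq]
  have h2 : ∑ β : F, ∑ x, (p : ℤ) * shiftCount p f β (f x - Algebra.trace (ZMod p) F (β * x)) =
      Fintype.card F ^ 3 + Fintype.card F ^ 2 * (p - 1) := by
    rw [Finset.sum_comm]
    have hx (x : F) : ∑ β : F,
        (p : ℤ) * shiftCount p f β (f x - Algebra.trace (ZMod p) F (β * x)) =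
        Fintype.card F ^ 2 + Fintype.card F * (p - 1) := by
      simp only [shiftCount, Finset.mul_sum]
      rw [Finset.sum_comm]
      have (y : F) : ∑ β : F, (p : ℤ) * (if f y - Algebra.trace (ZMod p) F (β * y) =
          f x - Algebra.trace (ZMod p) F (β * x) then 1 else 0) =
          Fintype.card F + if y = x then (Fintype.card F : ℤ) * (p - 1) else 0 := by
        have hiff (β : F) : f y - Algebra.trace (ZMod p) F (β * y) =
            f x - Algebra.trace (ZMod p) F (β * x) ↔
            Algebra.trace (ZMod p) F (β * (y - x)) = f y - f x := by
          rw [mul_sub, map_sub]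
          constructor <;> intro h <;> linear_combination (-1 : ZMod p) * h
        simp only [hiff]
        rw [← Finset.mul_sum, mul_sum_trace_eq_ite, sub_eq_zero]
        by_cases hyx : y = x
        · simp [hyx]
          ring
        · simp [hyx]
      rw [Finset.sum_congr rfl fun y _ => this y, Finset.sum_add_distrib]
      simp [sq]
    rw [Finset.sum_congr rfl fun x _ => hx x]
    simp
    ring
  rw [Finset.sum_congr rfl fun β _ => h1 β, Finset.sum_add_distrib, Finset.sum_ite_mem] at h2
  simp only [Finset.univ_inter, Finset.sum_const, Finset.card_univ, nsmul_eq_mul] at h2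
  refine mul_right_cancel₀ hp1 ?_
  linear_combination h2

theorem exists_dual_eq (H : HasShiftCounts p f g S K) (hf0 : f 0 = 0)
    (hK : K ≠ Fintype.card F) {c : ZMod p} (hc : c ≠ 0) : ∃ β ∈ S, g β = c := by
  by_contra! hno
  have h1 := H.mul_card_fiber_dual hf0 hc
  have h2 := H.sq_mul_card
  rw [Finset.filter_false_of_mem hno] at h1
  have hq : (Fintype.card F : ℤ) ≠ 0 := by exact_mod_cast Fintype.card_ne_zero
  refine hK (mul_right_cancel₀ hq ?_)
  simp only [Finset.card_empty, Nat.cast_zero, mul_zero, zero_sub] at h1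
  linear_combination h2 + K * h1

end HasShiftCounts

theorem cword_sub_smul (D : Finset F) (β γ : F) (a : ZMod p) :
    cword p D (β - algebraMap (ZMod p) F a * γ) = cword p D β - a • cword p D γ := by
  ext d
  simp only [cword, Pi.sub_apply, Pi.smul_apply, sub_mul, map_sub, mul_assoc, smul_eq_mul]
  rw [← Algebra.smul_def, map_smul, smul_eq_mul]

theorem wtOn_eq_sum (D : Finset F) (β : F) :
    (wtOn p D β : ℤ) = ∑ i, if cword p D β i ≠ 0 then 1 else 0 := by
  rw [wtOn, Finset.card_filter, ← Finset.sum_coe_sort]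
  push_cast
  rfl

theorem wtOn_pos_iff (D : Finset F) (β : F) : 0 < wtOn p D β ↔ cword p D β ≠ 0 := by
  rw [wtOn, Finset.card_pos, Function.ne_iff]
  simp [Finset.Nonempty, cword]

/-- If `u` covers `v`, the weights of the codewords `u - a v` sum to `p wt(u) - wt(v)`. -/
theorem sum_wtOn_of_covers {D : Finset F} {β γ : F} (h : Covers (cword p D β) (cword p D γ)) :
    ∑ a : ZMod p, (wtOn p D (β - algebraMap (ZMod p) F a * γ) : ℤ) =
      p * wtOn p D β - wtOn p D γ := by
  simp only [wtOn_eq_sum, cword_sub_smul]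
  rw [Finset.sum_comm, Finset.mul_sum, ← Finset.sum_sub_distrib]
  refine Finset.sum_congr rfl fun i _ => ?_
  have hi := h i
  set u := cword p D β i
  set v := cword p D γ i
  change ∑ a : ZMod p, (if u - a * v ≠ 0 then (1 : ℤ) else 0) = _
  by_cases hv : v = 0
  · simp [hv]
  · have (a : ZMod p) : (if u - a * v ≠ 0 then (1 : ℤ) else 0) =
        1 - if a = u / v then 1 else 0 := by
      have hiff : u - a * v ≠ 0 ↔ ¬a = u / v := by
        rw [eq_div_iff hv, sub_ne_zero, Ne, eq_comm]
      simp only [hiff]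
      split_ifs <;> simp_all
    simp [this, hv, hi hv]

/-- The Ashikhmin–Barg criterion for the codes `C_D`, with the parameters of the code. -/
theorem isMinimalCode_and_hasParams {D : Finset F} {m d w : ℤ} (hm : (D.card : ℤ) = m)
    (hd : 0 < d) (hlow : ∀ β, β ≠ 0 → d ≤ wtOn p D β) (hup : ∀ β, β ≠ 0 → (wtOn p D β : ℤ) ≤ w)
    (hdw : (p - 1) * w < p * d) (hex : ∃ β, β ≠ 0 ∧ (wtOn p D β : ℤ) = d) :
    IsMinimalCode p D ∧ HasParams p D m d := by
  have ne_zero {β : F} (h : cword p D β ≠ 0) : β ≠ 0 := by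
    rintro rfl
    exact h (by ext; simp [cword])
  have cword_ne {β : F} (h : β ≠ 0) : cword p D β ≠ 0 :=
    (wtOn_pos_iff D β).mp (by exact_mod_cast hd.trans_le (hlow β h))
  refine ⟨fun β hβ γ hγ hcov => ?_, hm, fun β γ h => ?_, fun β hβ => hlow β (ne_zero hβ), ?_⟩
  · by_contra! hno
    have hne (a : ZMod p) : β - algebraMap (ZMod p) F a * γ ≠ 0 := by
      intro h0
      have h : cword p D β = a • cword p D γ := by
        rw [← sub_eq_zero, ← cword_sub_smul, h0]
        ext
        simp [cword]
      have ha : a ≠ 0 := by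
        rintro rfl
        exact hβ (by simpa using h)
      exact hno a⁻¹ (inv_ne_zero ha) (by rw [h, inv_smul_smul₀ ha])
    have hsum := sum_wtOn_of_covers hcov
    have hle : (wtOn p D (β - algebraMap (ZMod p) F 0 * γ) : ℤ) - d ≤
        ∑ a : ZMod p, ((wtOn p D (β - algebraMap (ZMod p) F a * γ) : ℤ) - d) :=
      Finset.single_le_sum (f := fun a => (wtOn p D (β - algebraMap (ZMod p) F a * γ) : ℤ) - d)
        (fun a _ => sub_nonneg.mpr (hlow _ (hne a))) (Finset.mem_univ 0)
    rw [Finset.sum_sub_distrib, hsum] at hle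
    simp only [map_zero, zero_mul, sub_zero, Finset.sum_const, Finset.card_univ, ZMod.card,
      nsmul_eq_mul] at hle
    have h1 := hlow γ (ne_zero hγ)
    have h2 := hup β (ne_zero hβ)
    have hp1 : (0 : ℤ) ≤ p - 1 := by
      have : (1 : ℤ) ≤ p := by exact_mod_cast (Fact.out : p.Prime).one_le
      omega
    nlinarith [mul_le_mul_of_nonneg_left h2 hp1]
  · by_contra hne
    refine cword_ne (sub_ne_zero.mpr hne) ?_
    have := cword_sub_smul D β γ (1 : ZMod p)
    rwa [map_one, one_mul, one_smul, h, sub_self] at this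
  · obtain ⟨β, hβ, h⟩ := hex
    exact ⟨β, cword_ne hβ, h⟩

theorem sqrtPStar_sq {p : ℕ} [Fact p.Prime] (hp : p ≠ 2) :
    sqrtPStar p ^ 2 = eta0 p (-1) * p := by
  have hodd : p % 2 = 1 := (Fact.out : p.Prime).eq_two_or_odd.resolve_left hp
  have hsq : ((Real.sqrt p : ℝ) : ℂ) ^ 2 = p := by
    rw [← Complex.ofReal_pow, Real.sq_sqrt (Nat.cast_nonneg p), Complex.ofReal_natCast]
  rw [eta0, quadraticChar_neg_one (by rwa [ZMod.ringChar_zmod_n]), ZMod.card, sqrtPStar]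
  split_ifs with h
  · rw [hsq, ZMod.χ₄_nat_one_mod_four h]
    simp
  · rw [mul_pow, hsq, ZMod.χ₄_nat_three_mod_four (by omega)]
    simp

theorem sqrtPStar_pow {p : ℕ} [Fact p.Prime] (hp : p ≠ 2) {k : ℕ} (hk : Even k) :
    sqrtPStar p ^ k = eta0 p (-1) ^ (k / 2) * p ^ (k / 2) := by
  nth_rw 1 [← Nat.two_mul_div_two_of_even hk]
  rw [pow_mul, sqrtPStar_sq hp, mul_pow]

/-- For `f` in the class WRP with `n + s` even, the value distributions of all the functions
`x ↦ f(x) - Tr(βx)`, with `κ = ε η₀(-1)^{(n+s)/2}`. -/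
theorem IsWRP.exists_hasShiftCounts {n s : ℕ} {f g : F → ZMod p} {ε : ℂ}
    (hf : IsWRP p n s f ε g) (hp : p ≠ 2) (heven : Even (n + s)) {κ : ℤ}
    (hκ : ε * eta0 p (-1) ^ ((n + s) / 2) = κ) :
    ∃ S : Finset F, HasShiftCounts p f g S (κ * p ^ ((n + s) / 2)) ∧ 0 ∈ S ∧ g 0 = 0 ∧
      IsEvenHomogeneous p f := by
  obtain ⟨⟨-, hW, -⟩, hW0, hf0, hhom⟩ := hf
  have H : HasShiftCounts p f g _ (κ * p ^ ((n + s) / 2)) :=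
    hasShiftCounts_of_walsh fun β hβ => by
      rw [hW β hβ, sqrtPStar_pow hp heven, ← mul_assoc, hκ]
      simp
  exact ⟨_, H, by simpa using hW0, H.dual_zero hp hf0 (IsEvenHomogeneous.map_neg hhom), hhom⟩

theorem sqInd_of_mem {c : ZMod p} (h0 : c ≠ 0) (h : IsSquare c) : sqInd p c = 1 := by
  simp [sqInd, h0, h]

theorem sqInd_of_not_isSquare {c : ZMod p} (h : ¬IsSquare c) : sqInd p c = 0 := by
  simp [sqInd, h]

namespace HasShiftCounts

variable {f g : F → ZMod p} {S : Finset F} {κ : ℤ} {n m : ℕ}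

theorem card_Dsq_eq (H : HasShiftCounts p f g S (κ * p ^ (m + 2)))
    (hq : Fintype.card F = p ^ (n + 2)) (h0 : 0 ∈ S) (hg0 : g 0 = 0) :
    ((Dsq p f).card : ℤ) = (∑ c, sqInd p c) * (p ^ (n + 1) - κ * p ^ (m + 1)) := by
  have hp0 : (p : ℤ) ≠ 0 := by exact_mod_cast (Fact.out : p.Prime).ne_zero
  have h := H.mul_card_Dsq h0 hg0
  rw [hq] at h
  push_cast at h
  refine mul_left_cancel₀ hp0 ?_
  linear_combination h

theorem wtOn_eq (H : HasShiftCounts p f g S (κ * p ^ (m + 2))) (hκ : κ ≠ 0)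
    (hq : Fintype.card F = p ^ (n + 2)) (hf : IsEvenHomogeneous p f) (h0 : 0 ∈ S)
    (hg0 : g 0 = 0) {β : F} (hβ : β ≠ 0) :
    (wtOn p (Dsq p f) β : ℤ) = (p - 1) * ((∑ c, sqInd p c) * (p ^ n - κ * p ^ m) -
      if β ∈ S then κ * p ^ m * (p * sqInd p (g β) - ∑ c, sqInd p c) else 0) := by
  have hp0 : (p : ℤ) ≠ 0 := by exact_mod_cast (Fact.out : p.Prime).ne_zero
  have h := H.sq_mul_wtOn (mul_ne_zero hκ (pow_ne_zero _ hp0)) hf h0 hg0 hβ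
  rw [hq] at h
  push_cast at h
  refine mul_left_cancel₀ (pow_ne_zero 2 hp0) ?_
  split_ifs at h ⊢ <;> linear_combination h

theorem isMinimalCode_of_one (H : HasShiftCounts p f g S (1 * p ^ (m + 2))) (hp : p ≠ 2)
    (hq : Fintype.card F = p ^ (n + 2)) (hf0 : f 0 = 0) (hf : IsEvenHomogeneous p f)
    (h0 : 0 ∈ S) (hg0 : g 0 = 0) (hmn : m + 3 ≤ n) :
    IsMinimalCode p (Dsq p f) ∧ HasParams p (Dsq p f)
      ((∑ c, sqInd p c) * (p ^ (n + 1) - p ^ (m + 1)))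
      ((p - 1) * ((∑ c, sqInd p c) * p ^ n - p ^ (m + 1))) := by
  have hcard := H.card_Dsq_eq hq h0 hg0
  have hwt (β : F) (hβ : β ≠ 0) := H.wtOn_eq one_ne_zero hq hf h0 hg0 hβ
  have hsum := two_mul_sum_sqInd hp
  have hp3 : (3 : ℤ) ≤ p := by
    have := (Fact.out : p.Prime).two_le
    omega
  have hA : (p : ℤ) ^ m * p ^ 3 ≤ p ^ n := by
    rw [← pow_add]
    exact pow_le_pow_right₀ (by omega) hmn
  have hC : (0 : ℤ) < p ^ m := by positivity
  have hK : (1 * p ^ (m + 2) : ℤ) ≠ Fintype.card F := by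
    rw [hq, one_mul]
    norm_cast
    rw [Nat.pow_right_inj (Fact.out : p.Prime).one_lt]
    omega
  obtain ⟨β₀, hβ₀S, hβ₀⟩ := H.exists_dual_eq hf0 hK (one_ne_zero (α := ZMod p))
  have hβ₀0 : β₀ ≠ 0 := by
    rintro rfl
    exact one_ne_zero (hβ₀.symm.trans hg0)
  have hsq1 : sqInd p 1 = 1 := sqInd_of_mem one_ne_zero IsSquare.one
  simp only [one_mul] at hcard hwt
  rw [pow_succ (p : ℤ) m]
  rw [pow_succ (p : ℤ) m] at hcard
  generalize (p : ℤ) ^ m = C at *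
  generalize (p : ℤ) ^ n = A at *
  generalize ∑ c : ZMod p, sqInd p c = h at *
  have hh : (1 : ℤ) ≤ h := by omega
  have hpC : C * (p : ℤ) < C * p ^ 2 := mul_lt_mul_of_pos_left (by nlinarith) hC
  have hp2C : C * (p : ℤ) ^ 2 < h * A := by
    have h1 : C * (p : ℤ) ^ 2 < C * p ^ 3 := mul_lt_mul_of_pos_left (by nlinarith) hC
    have h2 : A ≤ h * A := le_mul_of_one_le_left (hA.trans' (by positivity)) hh
    linarith
  refine isMinimalCode_and_hasParams (w := (p - 1) * (h * A)) hcard ?_ ?_ ?_ ?_ ?_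
  · exact mul_pos (by omega) (by linarith)
  · intro β hβ
    rw [hwt β hβ]
    refine mul_le_mul_of_nonneg_left ?_ (by omega)
    have := sqInd_le_one (g β)
    split_ifs
    · nlinarith [mul_le_mul_of_nonneg_left this (mul_nonneg hC.le (by omega : (0 : ℤ) ≤ p))]
    · nlinarith
  · intro β hβ
    rw [hwt β hβ]
    refine mul_le_mul_of_nonneg_left ?_ (by omega)
    have := sqInd_nonneg (g β)
    split_ifs
    · nlinarith [mul_nonneg (mul_nonneg hC.le (by omega : (0 : ℤ) ≤ p)) this]
    · nlinarith
  · nlinarith [mul_lt_mul_of_pos_left hp2C (by omega : (0 : ℤ) < p - 1)]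
  · refine ⟨β₀, hβ₀0, ?_⟩
    rw [hwt β₀ hβ₀0, if_pos hβ₀S, hβ₀, hsq1]
    ring

theorem isMinimalCode_of_neg_one (H : HasShiftCounts p f g S (-1 * p ^ (m + 2))) (hp : p ≠ 2)
    (hq : Fintype.card F = p ^ (n + 2)) (hf0 : f 0 = 0) (hf : IsEvenHomogeneous p f)
    (h0 : 0 ∈ S) (hg0 : g 0 = 0) (hmn : m + 2 ≤ n) :
    IsMinimalCode p (Dsq p f) ∧ HasParams p (Dsq p f)
      ((∑ c, sqInd p c) * (p ^ (n + 1) + p ^ (m + 1)))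
      ((p - 1) * ((∑ c, sqInd p c) * p ^ n)) := by
  have hcard := H.card_Dsq_eq hq h0 hg0
  have hwt (β : F) (hβ : β ≠ 0) := H.wtOn_eq (by norm_num) hq hf h0 hg0 hβ
  have hsum := two_mul_sum_sqInd hp
  have hp3 : (3 : ℤ) ≤ p := by
    have := (Fact.out : p.Prime).two_le
    omega
  have hA : (p : ℤ) ^ m * p ^ 2 ≤ p ^ n := by
    rw [← pow_add]
    exact pow_le_pow_right₀ (by omega) hmn
  have hC : (0 : ℤ) < p ^ m := by positivity
  have hK : (-1 * p ^ (m + 2) : ℤ) ≠ Fintype.card F := by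
    have h1 : (0 : ℤ) < p ^ (m + 2) := by positivity
    have h2 : (0 : ℤ) ≤ Fintype.card F := by positivity
    intro h
    linarith
  obtain ⟨c, hc⟩ := FiniteField.exists_nonsquare (F := ZMod p) (by rwa [ZMod.ringChar_zmod_n])
  have hc0 : c ≠ 0 := by
    rintro rfl
    exact hc IsSquare.zero
  obtain ⟨β₀, hβ₀S, hβ₀⟩ := H.exists_dual_eq hf0 hK hc0
  have hβ₀0 : β₀ ≠ 0 := by
    rintro rfl
    exact hc0 (hβ₀.symm.trans hg0)
  have hsqc : sqInd p c = 0 := sqInd_of_not_isSquare hc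
  simp only [neg_mul, one_mul, sub_neg_eq_add] at hcard hwt
  rw [pow_succ (p : ℤ) m]
  rw [pow_succ (p : ℤ) m] at hcard
  generalize (p : ℤ) ^ m = C at *
  generalize (p : ℤ) ^ n = A at *
  generalize ∑ c : ZMod p, sqInd p c = h at *
  have hh : (1 : ℤ) ≤ h := by omega
  have hA0 : 0 < A := hA.trans_lt' (by positivity)
  refine isMinimalCode_and_hasParams (w := (p - 1) * (h * A + p * C)) hcard ?_ ?_ ?_ ?_ ?_
  · exact mul_pos (by omega) (by positivity)
  · intro β hβ
    rw [hwt β hβ]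
    refine mul_le_mul_of_nonneg_left ?_ (by omega)
    have := sqInd_nonneg (g β)
    split_ifs
    · nlinarith [mul_nonneg (mul_nonneg hC.le (by omega : (0 : ℤ) ≤ p)) this]
    · nlinarith
  · intro β hβ
    rw [hwt β hβ]
    refine mul_le_mul_of_nonneg_left ?_ (by omega)
    have := sqInd_le_one (g β)
    split_ifs
    · nlinarith [mul_le_mul_of_nonneg_left this (mul_nonneg hC.le (by omega : (0 : ℤ) ≤ p))]
    · nlinarith
  · have key : (p - 1) * (p * C) < h * A := by nlinarith [mul_pos hC (by omega : (0 : ℤ) < p)]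
    nlinarith [mul_lt_mul_of_pos_left key (by omega : (0 : ℤ) < p - 1)]
  · refine ⟨β₀, hβ₀0, ?_⟩
    rw [hwt β₀ hβ₀0, if_pos hβ₀S, hβ₀, hsqc]
    ring

end HasShiftCounts

end ShiftCounts

theorem statement_17 (p n s : ℕ) [Fact p.Prime] (hp : p ≠ 2) (hn : 0 < n) (hs : s ≤ n)
    {F : Type*} [Field F] [Fintype F] [Algebra (ZMod p) F]
    (hq : Fintype.card F = p ^ n)
    (f g : F → ZMod p) (ε : ℂ)
    (hf : IsWRP p n s f ε g)
    (heven : Even (n + s)) :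
    (ε * (eta0 p (-1)) ^ ((n + s) / 2) = 1 → s + 6 ≤ n →
      IsMinimalCode p (Dsq p f) ∧
      HasParams p (Dsq p f)
        (((p : ℤ) - 1) / 2 * ((p : ℤ) ^ (n - 1) - (p : ℤ) ^ ((n + s - 2) / 2)))
        (((p : ℤ) - 1) ^ 2 / 2 * (p : ℤ) ^ (n - 2) - ((p : ℤ) - 1) * (p : ℤ) ^ ((n + s - 2) / 2))) ∧
    (ε * (eta0 p (-1)) ^ ((n + s) / 2) = -1 → s + 4 ≤ n →
      IsMinimalCode p (Dsq p f) ∧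
      HasParams p (Dsq p f)
        (((p : ℤ) - 1) / 2 * ((p : ℤ) ^ (n - 1) + (p : ℤ) ^ ((n + s - 2) / 2)))
        (((p : ℤ) - 1) ^ 2 / 2 * (p : ℤ) ^ (n - 2))) := by
  have hsum := two_mul_sum_sqInd hp
  have hhalf : ((p : ℤ) - 1) / 2 = ∑ c : ZMod p, sqInd p c := by omega
  have hhalf' : ((p : ℤ) - 1) ^ 2 / 2 = (p - 1) * ∑ c : ZMod p, sqInd p c := by
    rw [← hsum]
    refine Int.ediv_eq_of_eq_mul_left two_ne_zero ?_
    ring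
  rw [hhalf, hhalf']
  obtain ⟨k, hk⟩ := heven
  refine ⟨fun hκ hsn => ?_, fun hκ hsn => ?_⟩
  all_goals
    obtain ⟨N, rfl⟩ : ∃ N, n = N + 2 := ⟨n - 2, by omega⟩
    obtain ⟨m, rfl⟩ : ∃ m, k = m + 2 := ⟨k - 2, by omega⟩
    have hm : (N + 2 + s) / 2 = m + 2 := by omega
    have hm' : (N + 2 + s - 2) / 2 = m + 1 := by omega
  · obtain ⟨S, H, h0, hg0, hhom⟩ :=
      hf.exists_hasShiftCounts hp ⟨_, hk⟩ (κ := 1) (by simpa using hκ)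
    rw [hm] at H
    have := H.isMinimalCode_of_one hp hq hf.2.2.1 hhom h0 hg0 (by omega)
    rw [hm', Nat.add_sub_cancel, show N + 2 - 1 = N + 1 by omega]
    convert this using 2
    ring
  · obtain ⟨S, H, h0, hg0, hhom⟩ :=
      hf.exists_hasShiftCounts hp ⟨_, hk⟩ (κ := -1) (by simpa using hκ)
    rw [hm] at H
    have := H.isMinimalCode_of_neg_one hp hq hf.2.2.1 hhom h0 hg0 (by omega)
    rw [hm', Nat.add_sub_cancel, show N + 2 - 1 = N + 1 by omega]
    convert this using 2
    ring
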